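/- arXiv:1208.5150 — 6 statements merged into one kernel-verified Lean document; each statement's English description precedes it below -/
import Mathlib

section
/- Let D1 be an m×m spherical Euclidean distance matrix generated by points lying on a hypersphere of radius ρ1 whose center lies in the affine span of those points, and let D2 be an n×n spherical Euclidean distance matrix generated by points lying on a hypersphere of radius ρ2 whose center lies in the affine span of those points. Then D = E_m ⊗ D2 + D1 ⊗ E_n is a spherical Euclidean distance matrix generated by points that lie on a hypersphere of radius ρ = (ρ1² + ρ2²)^{1/2} whose center lies in the affine span of those points. -/
open Matrix Kronecker

noncomputable section

/-- The k×k all-ones matrix. -/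
def onesMat (k : ℕ) : Matrix (Fin k) (Fin k) ℝ := Matrix.of fun _ _ => 1

/-- `p` is a configuration of points generating `D` as a Euclidean distance matrix. -/
def IsEDMGen {ι : Type} {r : ℕ} (D : Matrix ι ι ℝ)
    (p : ι → EuclideanSpace ℝ (Fin r)) : Prop :=
  ∀ i j, D i j = ‖p i - p j‖ ^ 2

/-- `D` is a spherical EDM generated by points lying on a hypersphere of radius `ρ`
whose center lies in the affine span of the points. -/
def IsSphericalEDMOfRadius {ι : Type} (D : Matrix ι ι ℝ) (ρ : ℝ) : Prop :=
  ∃ (r : ℕ) (p : ι → EuclideanSpace ℝ (Fin r)), IsEDMGen D p ∧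
    ∃ c ∈ affineSpan ℝ (Set.range p), ∀ i, dist (p i) c = ρ

/-- Affine maps from a product send a pair of points of two affine spans into the affine span of
the images of the pairs of generators. -/
theorem map_pair_mem_affineSpan {k V W U ι κ : Type*} [Ring k] [AddCommGroup V] [Module k V]
    [AddCommGroup W] [Module k W] [AddCommGroup U] [Module k U] (f : V × W →ᵃ[k] U)
    {p : ι → V} {q : κ → W} {a : V} {b : W} (ha : a ∈ affineSpan k (Set.range p))
    (hb : b ∈ affineSpan k (Set.range q)) :
    f (a, b) ∈ affineSpan k (Set.range fun x : ι × κ => f (p x.1, q x.2)) := by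
  have hab : (a, b) ∈ affineSpan k (Set.range (Prod.map p q)) := by
    rw [Set.range_prodMap, affineSpan_prod_eq]
    exact ⟨ha, hb⟩
  have hf := AffineSubspace.mem_map_of_mem f hab
  rwa [AffineSubspace.map_span, ← Set.range_comp] at hf

theorem spherical_kronecker_sum {m n : ℕ} {ρ1 ρ2 : ℝ}
    (D1 : Matrix (Fin m) (Fin m) ℝ) (D2 : Matrix (Fin n) (Fin n) ℝ)
    (h1 : IsSphericalEDMOfRadius D1 ρ1) (h2 : IsSphericalEDMOfRadius D2 ρ2) :
    IsSphericalEDMOfRadius (onesMat m ⊗ₖ D2 + D1 ⊗ₖ onesMat n)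
      (Real.sqrt (ρ1 ^ 2 + ρ2 ^ 2)) := by
  obtain ⟨r, p, hp, a, ha, hpa⟩ := h1
  obtain ⟨s, q, hq, b, hb, hqb⟩ := h2
  let V := WithLp 2 (EuclideanSpace ℝ (Fin r) × EuclideanSpace ℝ (Fin s))
  let e := (stdOrthonormalBasis ℝ V).repr
  let f : EuclideanSpace ℝ (Fin r) × EuclideanSpace ℝ (Fin s) →ₗ[ℝ]
      EuclideanSpace ℝ (Fin (Module.finrank ℝ V)) :=
    e.toLinearEquiv.toLinearMap ∘ₗ (WithLp.linearEquiv 2 ℝ _).symm.toLinearMap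
  have hf (x y) : ‖f x - f y‖ ^ 2 = ‖x.1 - y.1‖ ^ 2 + ‖x.2 - y.2‖ ^ 2 := by
    rw [← map_sub]
    exact (congrArg (· ^ 2) (e.norm_map _)).trans (WithLp.prod_norm_sq_eq_of_L2 _)
  refine ⟨_, fun x => f (p x.1, q x.2), fun x y => ?_, f (a, b),
    map_pair_mem_affineSpan f.toAffineMap ha hb, fun x => ?_⟩
  · rw [hf]
    simp [onesMat, hp x.1 y.1, hq x.2 y.2, add_comm]
  · rw [← hpa x.1, ← hqb x.2, dist_eq_norm, dist_eq_norm, dist_eq_norm, ← hf (p x.1, q x.2) (a, b),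
      Real.sqrt_sq (norm_nonneg _)]
end
end

section
/- Let D1 be an m×m real symmetric matrix and D2 an n×n real symmetric matrix, and suppose λ1 E_m − D1 and λ2 E_n − D2 are positive semidefinite for real scalars λ1, λ2. Then (λ1 + λ2) E_{mn} − (E_m ⊗ D2 + D1 ⊗ E_n) is positive semidefinite. -/
open Matrix Kronecker

noncomputable section

theorem onesMat_posSemidef (k : ℕ) : (onesMat k).PosSemidef := by
  convert posSemidef_vecMulVec_self_star (1 : Fin k → ℝ)
  ext i j
  simp [onesMat, vecMulVec_apply]

theorem psd_shift_kronecker_sum {m n : ℕ} {l1 l2 : ℝ}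
    (D1 : Matrix (Fin m) (Fin m) ℝ) (D2 : Matrix (Fin n) (Fin n) ℝ)
    (h1s : D1.IsSymm) (h2s : D2.IsSymm)
    (h1 : (l1 • onesMat m - D1).PosSemidef)
    (h2 : (l2 • onesMat n - D2).PosSemidef) :
    ((l1 + l2) • (onesMat m ⊗ₖ onesMat n) -
      (onesMat m ⊗ₖ D2 + D1 ⊗ₖ onesMat n)).PosSemidef := by
  have key : (l1 + l2) • (onesMat m ⊗ₖ onesMat n) - (onesMat m ⊗ₖ D2 + D1 ⊗ₖ onesMat n) =
      onesMat m ⊗ₖ (l2 • onesMat n - D2) + (l1 • onesMat m - D1) ⊗ₖ onesMat n := by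
    ext ⟨i, j⟩ ⟨k, l⟩
    simp only [Matrix.sub_apply, Matrix.add_apply, Matrix.smul_apply, kronecker_apply,
      smul_eq_mul]
    ring
  rw [key]
  exact ((onesMat_posSemidef m).kronecker h2).add (h1.kronecker (onesMat_posSemidef n))
end
end

section
/- Let D be an n×n regular Euclidean distance matrix, i.e., D is generated by points lying on a hypersphere of radius ρ centered at the centroid of the points. Then D e = 2 n ρ² e, where ρ² = (eᵀ D e)/(2n²) and e is the all-ones vector in ℝ^n. -/
open Matrix

noncomputable section

theorem sum_norm_sub_sq_of_sphere_centroid {ι E : Type*} [Fintype ι]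
    [NormedAddCommGroup E] [InnerProductSpace ℝ E] {p : ι → E} {c : E} {ρ : ℝ}
    (hc : ∑ j, (p j - c) = 0) (hsph : ∀ i, dist (p i) c = ρ) (i : ι) :
    ∑ j, ‖p i - p j‖ ^ 2 = 2 * (Fintype.card ι : ℝ) * ρ ^ 2 := by
  have hterm : ∀ j, ‖p i - p j‖ ^ 2 = 2 * ρ ^ 2 - 2 * inner ℝ (p i - c) (p j - c) := by
    intro j
    rw [← sub_sub_sub_cancel_right (p i) (p j) c, norm_sub_sq_real, ← dist_eq_norm,
      ← dist_eq_norm, hsph, hsph]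
    ring
  simp only [hterm, Finset.sum_sub_distrib, ← Finset.mul_sum, ← inner_sum, hc, inner_zero_right,
    Finset.sum_const, Finset.card_univ, nsmul_eq_mul]
  ring

theorem regular_edm_eigenvalue {n r : ℕ} (hn : 0 < n)
    (D : Matrix (Fin n) (Fin n) ℝ)
    (p : Fin n → EuclideanSpace ℝ (Fin r)) (ρ : ℝ)
    (hgen : ∀ i j, D i j = ‖p i - p j‖ ^ 2)
    (hsph : ∀ i, dist (p i) ((n : ℝ)⁻¹ • ∑ j, p j) = ρ) :
    D *ᵥ (fun _ => (1 : ℝ)) = (2 * (n : ℝ) * ρ ^ 2) • (fun _ => (1 : ℝ)) ∧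
      ρ ^ 2 = ((fun _ => (1 : ℝ)) ⬝ᵥ (D *ᵥ fun _ => (1 : ℝ))) / (2 * (n : ℝ) ^ 2) := by
  have hn0 : (n : ℝ) ≠ 0 := by positivity
  have hc : ∑ j, (p j - (n : ℝ)⁻¹ • ∑ k, p k) = 0 := by
    rw [Finset.sum_sub_distrib, Finset.sum_const, Finset.card_univ, Fintype.card_fin,
      ← Nat.cast_smul_eq_nsmul ℝ, smul_inv_smul₀ hn0, sub_self]
  have hD : D *ᵥ (fun _ => (1 : ℝ)) = (2 * (n : ℝ) * ρ ^ 2) • (fun _ => (1 : ℝ)) := by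
    ext i
    simpa [mulVec, dotProduct, hgen] using sum_norm_sub_sq_of_sphere_centroid hc hsph i
  refine ⟨hD, ?_⟩
  rw [hD]
  simp only [dotProduct, Pi.smul_apply, smul_eq_mul, mul_one, one_mul, Finset.sum_const,
    Finset.card_univ, Fintype.card_fin, nsmul_eq_mul]
  field_simp
end
end

section
/- Fix n ≥ 1 and let G_n be the n×n matrix with entries (G_n)_{ij} = |i − j|. For i = 1,…,n let q^i ∈ ℝ^{n−1} be the point whose first i−1 coordinates are 1 and whose remaining n−i coordinates are 0. Then (G_n)_{ij} = ‖q^i − q^j‖² for all i,j; the points q^1,…,q^n lie on a hypersphere of radius ½√(n−1) centered at b = (½,…,½)ᵀ; and the affine span of q^1,…,q^n has dimension n−1. In particular, G_n is a spherical Euclidean distance matrix of embedding dimension n−1. -/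
open Matrix

noncomputable section

/-- The Manhattan distance matrix of a 1×n grid: `(G_n)_{ij} = |i - j|`. -/
def Gmat (n : ℕ) : Matrix (Fin n) (Fin n) ℝ :=
  Matrix.of fun i j => |(i : ℝ) - (j : ℝ)|

/-- The point `q^i ∈ ℝ^{n-1}` whose first `i` coordinates (0-indexed: the
coordinates `k < i`) are 1 and whose remaining coordinates are 0. -/
def q (n : ℕ) (i : Fin n) : EuclideanSpace ℝ (Fin (n - 1)) :=
  (EuclideanSpace.equiv (Fin (n - 1)) ℝ).symm
    (fun k => if (k : ℕ) < (i : ℕ) then 1 else 0)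

theorem q_apply {n : ℕ} (i : Fin n) (k : Fin (n - 1)) :
    q n i k = if (k : ℕ) < (i : ℕ) then 1 else 0 := rfl

theorem sum_sq_q_sub_of_le {n : ℕ} {i j : Fin n} (h : i ≤ j) :
    ∑ k, (q n i k - q n j k) ^ 2 = (j : ℝ) - (i : ℝ) := by
  have hij : (i : ℕ) ≤ j := h
  have hterm (k : Fin (n - 1)) : (q n i k - q n j k) ^ 2 =
      (if (k : ℕ) < j then (1 : ℝ) else 0) - if (k : ℕ) < i then 1 else 0 := by
    rw [q_apply, q_apply]
    split_ifs <;> first | omega | norm_num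
  have hcard (m : Fin n) :
      ∑ k : Fin (n - 1), (if (k : ℕ) < m then (1 : ℝ) else 0) = m := by
    rw [Finset.sum_boole, Fin.card_filter_val_lt, min_eq_right (by omega)]
  rw [Finset.sum_congr rfl fun k _ => hterm k, Finset.sum_sub_distrib, hcard, hcard]

theorem norm_q_sub_sq {n : ℕ} (i j : Fin n) :
    ‖q n i - q n j‖ ^ 2 = |(i : ℝ) - (j : ℝ)| := by
  wlog h : i ≤ j generalizing i j
  · rw [norm_sub_rev, abs_sub_comm]
    exact this j i (le_of_not_ge h)
  · have hij : (i : ℝ) ≤ j := by exact_mod_cast h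
    rw [EuclideanSpace.real_norm_sq_eq, abs_of_nonpos (by linarith), neg_sub]
    exact sum_sq_q_sub_of_le h

theorem dist_q_center {n : ℕ} (i : Fin n) :
    dist (q n i) ((EuclideanSpace.equiv (Fin (n - 1)) ℝ).symm fun _ => (1 / 2 : ℝ)) =
      Real.sqrt ((n : ℝ) - 1) / 2 := by
  have hterm (k : Fin (n - 1)) : dist (q n i k)
      ((EuclideanSpace.equiv (Fin (n - 1)) ℝ).symm (fun _ => (1 / 2 : ℝ)) k) ^ 2 = 1 / 4 := by
    change dist (q n i k) (1 / 2 : ℝ) ^ 2 = 1 / 4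
    rw [q_apply, Real.dist_eq, sq_abs]
    split_ifs <;> norm_num
  have hn : 1 ≤ n := i.pos
  rw [EuclideanSpace.dist_eq, Finset.sum_congr rfl fun k _ => hterm k, Finset.sum_const,
    Finset.card_univ, Fintype.card_fin, nsmul_eq_mul, Nat.cast_sub hn, Nat.cast_one,
    mul_one_div, Real.sqrt_div' _ (by norm_num),
    show (4 : ℝ) = 2 ^ 2 by norm_num, Real.sqrt_sq (by norm_num)]

theorem single_eq_q_vsub {n : ℕ} (k : Fin (n - 1)) :
    EuclideanSpace.single k (1 : ℝ) =
      q n ⟨k + 1, by omega⟩ -ᵥ q n ⟨k, by omega⟩ := by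
  ext l
  rw [vsub_eq_sub, PiLp.sub_apply, q_apply, q_apply, PiLp.single_apply]
  simp only [Fin.ext_iff]
  split_ifs <;> first | omega | norm_num

theorem direction_affineSpan_range_q (n : ℕ) :
    (affineSpan ℝ (Set.range (q n))).direction = ⊤ := by
  rw [direction_affineSpan, eq_top_iff,
    ← (EuclideanSpace.basisFun (Fin (n - 1)) ℝ).toBasis.span_eq, Submodule.span_le]
  rintro _ ⟨k, rfl⟩
  rw [OrthonormalBasis.coe_toBasis, EuclideanSpace.basisFun_apply, single_eq_q_vsub]
  exact vsub_mem_vectorSpan ℝ (Set.mem_range_self _) (Set.mem_range_self _)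

theorem path_grid_spherical {n : ℕ} (hn : 1 ≤ n) :
    (∀ i j, Gmat n i j = ‖q n i - q n j‖ ^ 2) ∧
    (∀ i, dist (q n i)
        ((EuclideanSpace.equiv (Fin (n - 1)) ℝ).symm fun _ => (1 / 2 : ℝ)) =
      Real.sqrt ((n : ℝ) - 1) / 2) ∧
    Module.finrank ℝ (affineSpan ℝ (Set.range (q n))).direction = n - 1 := by
  refine ⟨fun i j => (norm_q_sub_sq i j).symm, dist_q_center, ?_⟩
  rw [direction_affineSpan_range_q, finrank_top, finrank_euclideanSpace_fin]
end
end

section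
/- Let D be the mn×mn Manhattan distance matrix of the rectangular grid with m rows and n columns, i.e., the matrix indexed by pairs (j,i) with j ∈ {1,…,m}, i ∈ {1,…,n}, whose entry at ((j,i),(l,k)) equals |i − k| + |j − l|. Then D is a spherical Euclidean distance matrix of embedding dimension n + m − 2, and the points that generate D lie on a hypersphere of radius ½√(n + m − 2). -/
open Matrix

noncomputable section

/-- The Manhattan distance matrix of the m×n rectangular grid, indexed by pairs
`(j, i)` with `j` the row and `i` the column. -/
def manhattan (m n : ℕ) : Matrix (Fin m × Fin n) (Fin m × Fin n) ℝ :=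
  Matrix.of fun s t =>
    |(s.2 : ℝ) - (t.2 : ℝ)| + |(s.1 : ℝ) - (t.1 : ℝ)|

theorem sum_indicator_lt {b i : ℕ} (hi : i ≤ b) :
    ∑ l : Fin b, (if (l : ℕ) < i then (1 : ℝ) else 0) = i := by
  rw [Fin.sum_univ_eq_sum_range (fun l => if l < i then (1 : ℝ) else 0) b, Finset.sum_boole]
  congr 2
  rw [show (Finset.range b).filter (fun l => l < i) = Finset.range i by
    ext l
    simp only [Finset.mem_filter, Finset.mem_range]
    omega, Finset.card_range]

theorem sum_indicator_lt_sub_sq {b i k : ℕ} (hi : i ≤ b) (hk : k ≤ b) :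
    ∑ l : Fin b, ((if (l : ℕ) < i then (1 : ℝ) else 0) - (if (l : ℕ) < k then 1 else 0)) ^ 2 =
      |(i : ℝ) - k| := by
  wlog hik : i ≤ k generalizing i k
  · rw [abs_sub_comm, ← this hk hi (by omega)]
    exact Finset.sum_congr rfl fun l _ => by ring
  have hterm : ∀ l : Fin b,
      ((if (l : ℕ) < i then (1 : ℝ) else 0) - (if (l : ℕ) < k then 1 else 0)) ^ 2 =
        (if (l : ℕ) < k then 1 else 0) - (if (l : ℕ) < i then 1 else 0) := by
    intro l
    split_ifs <;> first | omega | norm_num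
  have hle : (i : ℝ) ≤ k := by exact_mod_cast hik
  rw [Finset.sum_congr rfl fun l _ => hterm l, Finset.sum_sub_distrib, sum_indicator_lt hi,
    sum_indicator_lt hk, abs_of_nonpos (by linarith)]
  ring

/-- The vertex of the unit cube whose first `b` coordinates are the unary code of the column and
whose last `a` coordinates are the unary code of the row. -/
def gridVertex (a b : ℕ) (s : Fin (a + 1) × Fin (b + 1)) : EuclideanSpace ℝ (Fin (b + a)) :=
  WithLp.toLp 2 (Fin.append (fun l => if (l : ℕ) < s.2 then (1 : ℝ) else 0)
    (fun l => if (l : ℕ) < s.1 then (1 : ℝ) else 0))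

theorem manhattan_eq_norm_gridVertex_sub_sq (a b : ℕ) (s t : Fin (a + 1) × Fin (b + 1)) :
    manhattan (a + 1) (b + 1) s t = ‖gridVertex a b s - gridVertex a b t‖ ^ 2 := by
  rw [EuclideanSpace.real_norm_sq_eq, Fin.sum_univ_add]
  simp only [gridVertex, manhattan, Matrix.of_apply, PiLp.sub_apply, Fin.append_left,
    Fin.append_right]
  rw [sum_indicator_lt_sub_sq (by omega) (by omega), sum_indicator_lt_sub_sq (by omega) (by omega)]

theorem vectorSpan_range_gridVertex (a b : ℕ) :
    vectorSpan ℝ (Set.range (gridVertex a b)) = ⊤ := by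
  rw [eq_top_iff, ← (EuclideanSpace.basisFun (Fin (b + a)) ℝ).toBasis.span_eq, Submodule.span_le]
  rintro _ ⟨k, rfl⟩
  have key : ∃ s t, (EuclideanSpace.basisFun (Fin (b + a)) ℝ).toBasis k =
      gridVertex a b s - gridVertex a b t := by
    induction k using Fin.addCases with
    | left k =>
      refine ⟨(0, k.succ), (0, k.castSucc), ?_⟩
      ext l
      induction l using Fin.addCases with
      | left l =>
        simp only [gridVertex, OrthonormalBasis.coe_toBasis, EuclideanSpace.basisFun_apply,
          PiLp.single_apply, PiLp.sub_apply, Fin.append_left, Fin.ext_iff,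
          Fin.val_castAdd, Fin.val_succ, Fin.val_castSucc]
        split_ifs <;> first | omega | norm_num
      | right l =>
        simp [gridVertex, Fin.ext_iff]
        omega
    | right k =>
      refine ⟨(k.succ, 0), (k.castSucc, 0), ?_⟩
      ext l
      induction l using Fin.addCases with
      | left l =>
        simp [gridVertex, Fin.ext_iff]
        omega
      | right l =>
        simp only [gridVertex, OrthonormalBasis.coe_toBasis, EuclideanSpace.basisFun_apply,
          PiLp.single_apply, PiLp.sub_apply, Fin.append_right, Fin.ext_iff,
          Fin.val_natAdd, Fin.val_succ, Fin.val_castSucc]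
        split_ifs <;> first | omega | norm_num
  obtain ⟨s, t, hst⟩ := key
  rw [hst]
  exact vsub_mem_vectorSpan ℝ (Set.mem_range_self s) (Set.mem_range_self t)

theorem dist_gridVertex_center (a b : ℕ) (s : Fin (a + 1) × Fin (b + 1)) :
    dist (gridVertex a b s) (WithLp.toLp 2 fun _ => 1 / 2) = √((b : ℝ) + a) / 2 := by
  have hterm : ∀ l, (gridVertex a b s l - 1 / 2) ^ 2 = 1 / 4 := by
    intro l
    induction l using Fin.addCases <;>
      simp only [gridVertex, Fin.append_left, Fin.append_right] <;> split_ifs <;> norm_num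
  rw [EuclideanSpace.dist_eq]
  simp only [Real.dist_eq, sq_abs, hterm]
  rw [Finset.sum_const, Finset.card_univ, Fintype.card_fin, nsmul_eq_mul,
    show ((b + a : ℕ) : ℝ) * (1 / 4) = ((b : ℝ) + a) / 2 ^ 2 by push_cast; ring,
    Real.sqrt_div' _ (by norm_num), Real.sqrt_sq (by norm_num)]

theorem manhattan_spherical_edm {m n : ℕ} (hm : 1 ≤ m) (hn : 1 ≤ n) :
    ∃ (r : ℕ) (p : Fin m × Fin n → EuclideanSpace ℝ (Fin r)),
      (∀ s t, manhattan m n s t = ‖p s - p t‖ ^ 2) ∧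
      Module.finrank ℝ (affineSpan ℝ (Set.range p)).direction = n + m - 2 ∧
      ∃ c : EuclideanSpace ℝ (Fin r),
        ∀ s, dist (p s) c = Real.sqrt ((n : ℝ) + (m : ℝ) - 2) / 2 := by
  obtain ⟨a, rfl⟩ := Nat.exists_eq_add_of_le' hm
  obtain ⟨b, rfl⟩ := Nat.exists_eq_add_of_le' hn
  refine ⟨b + a, gridVertex a b, manhattan_eq_norm_gridVertex_sub_sq a b, ?_,
    WithLp.toLp 2 fun _ => 1 / 2, fun s => ?_⟩
  · rw [direction_affineSpan, vectorSpan_range_gridVertex, finrank_top, finrank_euclideanSpace_fin]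
    omega
  · rw [dist_gridVertex_center]
    congr 2
    push_cast
    ring
end
end

section
/- Let D be the mn×mn Manhattan distance matrix of the rectangular grid with m rows and n columns, i.e., the matrix indexed by pairs (j,i) with j ∈ {1,…,m}, i ∈ {1,…,n}, whose entry at ((j,i),(l,k)) equals |i − k| + |j − l|. Then ((n + m − 2)/2) E_{mn} − D is positive semidefinite, where E_{mn} is the mn×mn all-ones matrix. -/
open Matrix

noncomputable section

/-- The mn×mn all-ones matrix, indexed by pairs. -/
def onesMat2 (m n : ℕ) : Matrix (Fin m × Fin n) (Fin m × Fin n) ℝ :=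
  Matrix.of fun _ _ => 1

/-- The sign, `1` or `-1`, of the side of the cut between `k` and `k + 1` on which `a` lies. -/
def cutSign (k a : ℕ) : ℝ := if a ≤ k then 1 else -1

theorem cutSign_mul_cutSign {a b : ℕ} (hab : a ≤ b) (k : ℕ) :
    cutSign k a * cutSign k b = 1 - 2 * (if k ∈ Finset.Ico a b then 1 else 0) := by
  simp only [cutSign, Finset.mem_Ico]
  split_ifs <;> first | omega | norm_num

theorem sum_cutSign_mul_cutSign {N a b : ℕ} (ha : a ≤ N) (hb : b ≤ N) :
    ∑ k ∈ Finset.range N, cutSign k a * cutSign k b = N - 2 * |(a : ℝ) - b| := by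
  wlog hab : a ≤ b generalizing a b
  · rw [abs_sub_comm, ← this hb ha (le_of_not_ge hab)]
    simp only [mul_comm]
  have hinter : Finset.range N ∩ Finset.Ico a b = Finset.Ico a b :=
    Finset.inter_eq_right.mpr fun k hk =>
      Finset.mem_range.mpr ((Finset.mem_Ico.mp hk).2.trans_le hb)
  have hcast : (a : ℝ) ≤ b := by exact_mod_cast hab
  simp only [cutSign_mul_cutSign hab, Finset.sum_sub_distrib, ← Finset.mul_sum,
    Finset.sum_ite_mem, hinter]
  simp only [Finset.sum_const, Finset.card_range, Nat.card_Ico, nsmul_eq_mul, mul_one,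
    Nat.cast_sub hab]
  rw [abs_of_nonpos (sub_nonpos.mpr hcast), neg_sub]

/-- If `f` takes values in `{0, …, N}`, then the kernel `N / 2 - |f s - f t|` is positive
semidefinite. -/
theorem posSemidef_half_sub_abs_sub {ι : Type*} [Fintype ι] {N : ℕ} {f : ι → ℕ}
    (hf : ∀ s, f s ≤ N) :
    (Matrix.of fun s t => (N : ℝ) / 2 - |(f s : ℝ) - (f t : ℝ)|).PosSemidef := by
  let S : Matrix (Fin N) ι ℝ := Matrix.of fun k s => cutSign k (f s)
  have hS : (Matrix.of fun s t => (N : ℝ) / 2 - |(f s : ℝ) - (f t : ℝ)|) =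
      (1 / 2 : ℝ) • (Sᴴ * S) := by
    ext s t
    have h := sum_cutSign_mul_cutSign (hf s) (hf t)
    rw [Finset.sum_range] at h
    simp only [Matrix.smul_apply, Matrix.mul_apply, Matrix.conjTranspose_apply, Matrix.of_apply,
      S, star_trivial, h, smul_eq_mul]
    ring
  rw [hS]
  exact (Matrix.posSemidef_conjTranspose_mul_self S).smul (by norm_num)

theorem manhattan_psd_bound {m n : ℕ} (hm : 1 ≤ m) (hn : 1 ≤ n) :
    ((((n : ℝ) + (m : ℝ) - 2) / 2) • onesMat2 m n - manhattan m n).PosSemidef := by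
  have hrow : ∀ s : Fin m × Fin n, (s.1 : ℕ) ≤ m - 1 := fun s => Nat.le_sub_one_of_lt s.1.isLt
  have hcol : ∀ s : Fin m × Fin n, (s.2 : ℕ) ≤ n - 1 := fun s => Nat.le_sub_one_of_lt s.2.isLt
  convert (posSemidef_half_sub_abs_sub hcol).add (posSemidef_half_sub_abs_sub hrow) using 1
  ext s t
  simp only [manhattan, onesMat2, Matrix.sub_apply, Matrix.add_apply, Matrix.smul_apply,
    Matrix.of_apply, smul_eq_mul, Nat.cast_sub hm, Nat.cast_sub hn, Nat.cast_one]
  ring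
end
end
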